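/- arXiv:2406.00206 — 2 statements merged into one kernel-verified Lean document; each statement's English description precedes it below -/
import Mathlib

section
/- Let p be a prime and q ∈ ℤ_p with ‖q − 1‖_p ≤ 1/p. Then each q-integer [i]_q = ∑_{k=0}^{i−1} q^k with p ∤ i is a unit of ℤ_p, and there exists a unique continuous function G : ℤ_p × ℤ_p → ℚ_p such that for all natural numbers n, h: G(n, h) = (∏_{0<i<pn+ph, p∤i} [i]_q) / ((∏_{0<i<pn, p∤i} [i]_q) · (∏_{0<i<ph, p∤i} [i]_q)). In other words, the function (n,h) ↦ Γ_{p,q}(pn+ph)/(Γ_{p,q}(pn)·Γ_{p,q}(ph)) on ℕ × ℕ extends continuously to ℤ_p × ℤ_p. -/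
/-- The `q`-integer `[i]_q = ∑_{k=0}^{i-1} q^k` in `ℤ_p`. -/
noncomputable def qInt {p : ℕ} [Fact p.Prime] (q : ℤ_[p]) (i : ℕ) : ℤ_[p] :=
  ∑ k ∈ Finset.range i, q ^ k

/-- The product `∏_{0<i<N, p∤i} [i]_q` in `ℤ_p`. -/
noncomputable def qGammaProd {p : ℕ} [Fact p.Prime] (q : ℤ_[p]) (N : ℕ) : ℤ_[p] :=
  ∏ i ∈ (Finset.Ioo 0 N).filter (fun i => ¬ p ∣ i), qInt q i

theorem qInt_add {p : ℕ} [Fact p.Prime] (q : ℤ_[p]) (a b : ℕ) :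
    qInt q (a + b) = qInt q a + q ^ a * qInt q b := by
  simp [qInt, Finset.sum_range_add, pow_add, Finset.mul_sum]

theorem qInt_mul {p : ℕ} [Fact p.Prime] (q : ℤ_[p]) (a b : ℕ) :
    qInt q (a * b) = qInt q a * qInt (q ^ a) b := by
  induction b with
  | zero => simp [qInt]
  | succ b ih =>
    rw [Nat.mul_succ, qInt_add, ih, qInt_add (q ^ a)]
    simp [qInt, pow_mul]
    ring

theorem dvd_qInt_sub_natCast {p : ℕ} [Fact p.Prime] {q d : ℤ_[p]} (hq : d ∣ q - 1) (i : ℕ) :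
    d ∣ qInt q i - i := by
  have h : qInt q i - i = ∑ k ∈ Finset.range i, (q ^ k - 1) := by
    simp [qInt]
  rw [h]
  exact Finset.dvd_sum fun k _ => hq.trans (sub_one_dvd_pow_sub_one q k)

theorem pow_dvd_qInt {p : ℕ} [Fact p.Prime] {q : ℤ_[p]} (hq : (p : ℤ_[p]) ∣ q - 1)
    {m N : ℕ} (hN : p ^ m ∣ N) : (p : ℤ_[p]) ^ m ∣ qInt q N := by
  obtain ⟨c, rfl⟩ := hN
  rw [qInt_mul]
  refine Dvd.dvd.mul_right ?_ _
  induction m with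
  | zero => simp
  | succ m ih =>
    rw [pow_succ, pow_succ, qInt_mul]
    refine mul_dvd_mul ih ?_
    have h := dvd_qInt_sub_natCast (hq.trans (sub_one_dvd_pow_sub_one q (p ^ m))) p
    exact (dvd_sub_self_right).1 h

theorem isUnit_qInt {p : ℕ} [Fact p.Prime] {q : ℤ_[p]} (hq : (p : ℤ_[p]) ∣ q - 1)
    {i : ℕ} (hi : ¬ p ∣ i) : IsUnit (qInt q i) := by
  by_contra h
  have h1 : (p : ℤ_[p]) ∣ qInt q i := by
    rw [← PadicInt.norm_lt_one_iff_dvd]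
    exact PadicInt.mem_nonunits.1 h
  have h2 : (p : ℤ_[p]) ∣ (i : ℤ_[p]) := by
    simpa using dvd_sub h1 (dvd_qInt_sub_natCast hq i)
  refine hi ?_
  rw [← PadicInt.norm_lt_one_iff_dvd] at h2
  exact_mod_cast (PadicInt.norm_int_lt_one_iff_dvd (i : ℤ)).1 (by simpa using h2)

theorem qGammaProd_eq_prod_range {p : ℕ} [Fact p.Prime] (q : ℤ_[p]) (N : ℕ) :
    qGammaProd q N = ∏ i ∈ Finset.range N, if p ∣ i then 1 else qInt q i := by
  rw [qGammaProd, Finset.prod_filter]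
  simp only [ite_not]
  refine Finset.prod_subset (fun i hi => by simp at hi ⊢; lia) fun i hi hi' => ?_
  obtain rfl : i = 0 := by simp at hi hi'; lia
  simp

theorem norm_qGammaProd {p : ℕ} [Fact p.Prime] {q : ℤ_[p]} (hq : (p : ℤ_[p]) ∣ q - 1) (N : ℕ) :
    ‖qGammaProd q N‖ = 1 := by
  rw [← PadicInt.isUnit_iff, qGammaProd, IsUnit.prod_iff]
  intro i hi
  exact isUnit_qInt hq (Finset.mem_filter.1 hi).2

/-- Modulo `p ^ m`, the product `∏_{0<i<N, p∤i} [i]_q` is multiplicative under translation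
by a multiple of `p ^ m`. -/
theorem toZModPow_qGammaProd_add {p : ℕ} [Fact p.Prime] {q : ℤ_[p]} (hq : (p : ℤ_[p]) ∣ q - 1)
    {m a : ℕ} (hm : m ≠ 0) (ha : p ^ m ∣ a) (b : ℕ) :
    PadicInt.toZModPow m (qGammaProd q (a + b)) =
      PadicInt.toZModPow m (qGammaProd q a) * PadicInt.toZModPow m (qGammaProd q b) := by
  simp only [qGammaProd_eq_prod_range, Finset.prod_range_add, map_mul, map_prod]
  congr 1
  refine Finset.prod_congr rfl fun j _ => ?_
  simp only [Nat.dvd_add_right ((dvd_pow_self p hm).trans ha)]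
  split_ifs
  · rfl
  · have h0 : PadicInt.toZModPow m (qInt q a) = 0 := by
      rw [← RingHom.mem_ker, PadicInt.ker_toZModPow, Ideal.mem_span_singleton]
      exact pow_dvd_qInt hq ha
    rw [add_comm, qInt_add, map_add, map_mul, h0, mul_zero, add_zero]

theorem norm_le_pow_of_toZModPow_eq {p : ℕ} [Fact p.Prime] {x y : ℤ_[p]} {m : ℕ}
    (h : PadicInt.toZModPow m x = PadicInt.toZModPow m y) :
    ‖x - y‖ ≤ (p : ℝ) ^ (-m : ℤ) := by
  rw [PadicInt.norm_le_pow_iff_mem_span_pow, ← PadicInt.ker_toZModPow, RingHom.mem_ker, map_sub,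
    h, sub_self]

/-- The ratio `Γ_{p,q}(pn+ph) / (Γ_{p,q}(pn)·Γ_{p,q}(ph))` for natural numbers `n` and `h`. -/
noncomputable def qGammaRatio {p : ℕ} [Fact p.Prime] (q : ℤ_[p]) (n h : ℕ) : ℚ_[p] :=
  ((qGammaProd q (p * n + p * h) : ℤ_[p]) : ℚ_[p]) /
    (((qGammaProd q (p * n) : ℤ_[p]) : ℚ_[p]) * ((qGammaProd q (p * h) : ℤ_[p]) : ℚ_[p]))

theorem norm_qGammaRatio_add_sub_le {p : ℕ} [Fact p.Prime] {q : ℤ_[p]}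
    (hq : (p : ℤ_[p]) ∣ q - 1) {m A B : ℕ} (hm : m ≠ 0) (hA : p ^ m ∣ A) (hB : p ^ m ∣ B)
    (r s : ℕ) :
    ‖qGammaRatio q (A + r) (B + s) - qGammaRatio q r s‖ ≤ (p : ℝ) ^ (-m : ℤ) := by
  have hnorm : ∀ N, ‖((qGammaProd q N : ℤ_[p]) : ℚ_[p])‖ = 1 := norm_qGammaProd hq
  have hne : ∀ N, ((qGammaProd q N : ℤ_[p]) : ℚ_[p]) ≠ 0 := fun N =>
    norm_ne_zero_iff.1 (by rw [hnorm]; exact one_ne_zero)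
  have hA' : p ^ m ∣ p * A := hA.mul_left p
  have hB' : p ^ m ∣ p * B := hB.mul_left p
  have key : PadicInt.toZModPow m (qGammaProd q (p * (A + r) + p * (B + s)) *
        (qGammaProd q (p * r) * qGammaProd q (p * s))) =
      PadicInt.toZModPow m ((qGammaProd q (p * (A + r)) * qGammaProd q (p * (B + s))) *
        qGammaProd q (p * r + p * s)) := by
    rw [show p * (A + r) + p * (B + s) = p * A + (p * B + (p * r + p * s)) by ring,
      mul_add p A, mul_add p B]
    simp only [map_mul, toZModPow_qGammaProd_add hq hm hA', toZModPow_qGammaProd_add hq hm hB']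
    ring
  rw [qGammaRatio, qGammaRatio, div_sub_div _ _ (mul_ne_zero (hne _) (hne _))
    (mul_ne_zero (hne _) (hne _)), norm_div]
  simp only [norm_mul, hnorm, mul_one, div_one]
  exact_mod_cast norm_le_pow_of_toZModPow_eq key

theorem dist_qGammaRatio_le {p : ℕ} [Fact p.Prime] {q : ℤ_[p]}
    (hq : (p : ℤ_[p]) ∣ q - 1) {m n n' h h' : ℕ} (hm : m ≠ 0) (hn : n ≡ n' [MOD p ^ m])
    (hh : h ≡ h' [MOD p ^ m]) :
    dist (qGammaRatio q n h) (qGammaRatio q n' h') ≤ (p : ℝ) ^ (-m : ℤ) := by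
  have reduce : ∀ n h, dist (qGammaRatio q n h) (qGammaRatio q (n % p ^ m) (h % p ^ m)) ≤
      (p : ℝ) ^ (-m : ℤ) := fun n h => by
    have := norm_qGammaRatio_add_sub_le hq hm (dvd_mul_right (p ^ m) (n / p ^ m))
      (dvd_mul_right (p ^ m) (h / p ^ m)) (n % p ^ m) (h % p ^ m)
    rwa [Nat.div_add_mod, Nat.div_add_mod, ← dist_eq_norm] at this
  have h2 := reduce n' h'
  rw [← hn, ← hh, dist_comm] at h2
  exact (IsUltrametricDist.dist_triangle_max _ _ _).trans (max_le (reduce n h) h2)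

theorem PadicInt.natCast_modEq_of_dist_le {p : ℕ} [Fact p.Prime] {m a b : ℕ}
    (h : dist (a : ℤ_[p]) b ≤ (p : ℝ) ^ (-m : ℤ)) : a ≡ b [MOD p ^ m] := by
  rw [dist_comm, dist_eq_norm] at h
  rw [Nat.modEq_iff_dvd]
  exact_mod_cast (PadicInt.norm_int_le_pow_iff_dvd (p := p)).1 (by exact_mod_cast h)

theorem DenseRange.exists_continuousMap_extend {α X Y : Type*} [UniformSpace X] [UniformSpace Y]
    [CompleteSpace Y] [T0Space Y] {e : α → X} (he : DenseRange e) {f : α → Y}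
    (hf : Filter.Tendsto (Prod.map f f) ((uniformity X).comap (Prod.map e e)) (uniformity Y)) :
    ∃ g : C(X, Y), ∀ a, g (e a) = f a := by
  let _ : UniformSpace α := UniformSpace.comap e inferInstance
  have hu : IsUniformInducing e := ⟨rfl⟩
  have hfu : UniformContinuous f := hf
  exact ⟨⟨_, (uniformContinuous_uniformly_extend hu he hfu).continuous⟩,
    fun a => uniformly_extend_of_ind hu he hfu a⟩

theorem PadicInt.denseRange_natCast_prod (p : ℕ) [Fact p.Prime] :
    DenseRange (Prod.map (Nat.cast : ℕ → ℤ_[p]) (Nat.cast : ℕ → ℤ_[p])) :=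
  PadicInt.denseRange_natCast.prodMap PadicInt.denseRange_natCast

theorem exists_continuousMap_qGammaRatio {p : ℕ} [Fact p.Prime] {q : ℤ_[p]}
    (hq : (p : ℤ_[p]) ∣ q - 1) :
    ∃ G : C(ℤ_[p] × ℤ_[p], ℚ_[p]), ∀ x : ℕ × ℕ,
      G (Prod.map Nat.cast Nat.cast x) = qGammaRatio q x.1 x.2 := by
  refine (PadicInt.denseRange_natCast_prod p).exists_continuousMap_extend ?_
  rw [((Metric.uniformity_basis_dist_le).comap _).tendsto_iff Metric.uniformity_basis_dist]
  intro ε hε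
  have hp : (1 : ℝ) < p := mod_cast (Fact.out : p.Prime).one_lt
  obtain ⟨m, hm⟩ := exists_pow_lt_of_lt_one hε (inv_lt_one_of_one_lt₀ hp)
  refine ⟨(p : ℝ) ^ (-(m + 1 : ℕ) : ℤ), by positivity, fun ⟨⟨n, h⟩, ⟨n', h'⟩⟩ hx => ?_⟩
  have hx' := max_le_iff.1 (Prod.dist_eq.symm.trans_le hx)
  refine lt_of_le_of_lt (dist_qGammaRatio_le hq m.succ_ne_zero
    (PadicInt.natCast_modEq_of_dist_le hx'.1) (PadicInt.natCast_modEq_of_dist_le hx'.2))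
    (lt_of_le_of_lt ?_ hm)
  rw [inv_pow, ← zpow_natCast, ← zpow_neg]
  exact zpow_le_zpow_right₀ hp.le (by simp)

/-- for `q ∈ ℤ_p` with `‖q - 1‖ ≤ 1/p`, each `[i]_q` with `p ∤ i` is a unit
of `ℤ_p`, and the function `(n, h) ↦ Γ_{p,q}(pn+ph) / (Γ_{p,q}(pn)·Γ_{p,q}(ph))` on
`ℕ × ℕ` extends uniquely to a continuous function `ℤ_p × ℤ_p → ℚ_p`. -/
theorem qgamma_ratio_extends_continuously
    (p : ℕ) (hp : p.Prime) [Fact p.Prime] (q : ℤ_[p]) (hq : ‖q - 1‖ ≤ (p : ℝ)⁻¹) :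
    (∀ i : ℕ, ¬ p ∣ i → IsUnit (qInt q i)) ∧
    (∃! G : C(ℤ_[p] × ℤ_[p], ℚ_[p]), ∀ n h : ℕ,
      G ((n : ℤ_[p]), (h : ℤ_[p])) =
        ((qGammaProd q (p * n + p * h) : ℤ_[p]) : ℚ_[p]) /
          (((qGammaProd q (p * n) : ℤ_[p]) : ℚ_[p]) *
            ((qGammaProd q (p * h) : ℤ_[p]) : ℚ_[p]))) := by
  have hdvd : (p : ℤ_[p]) ∣ q - 1 := by
    rw [← PadicInt.norm_lt_one_iff_dvd]
    exact hq.trans_lt (inv_lt_one_of_one_lt₀ (mod_cast hp.one_lt))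
  refine ⟨fun i hi => isUnit_qInt hdvd hi, ?_⟩
  obtain ⟨G, hG⟩ := exists_continuousMap_qGammaRatio hdvd
  refine ⟨G, fun n h => hG (n, h), fun G' hG' => DFunLike.coe_injective ?_⟩
  refine (PadicInt.denseRange_natCast_prod p).equalizer G'.continuous G.continuous ?_
  funext x
  exact (hG' x.1 x.2).trans (hG x).symm
end

section
/- (Koblitz) Let p be a prime and q ∈ ℤ_p with ‖q − 1‖_p ≤ 1/p. Then there exists a unique continuous function f : ℤ_p → ℚ_p such that for every natural number n, f(n) = (−1)^n · ∏_{0<i<n, p∤i} [i]_q, where [i]_q = ∑_{k=0}^{i−1} q^k. (For q = 1 this is Morita's p-adic gamma function Γ_p; for general such q it is the p-adic q-gamma function Γ_{p,q}.) -/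
section Congruences

variable {R : Type*} [CommRing R]

lemma dvd_geom_sum_of_dvd_sub_one {n : ℕ} {a : R} (h : (n : R) ∣ a - 1) :
    (n : R) ∣ ∑ i ∈ Finset.range n, a ^ i := by
  have h₁ : (n : R) ∣ ∑ i ∈ Finset.range n, (a ^ i - 1) :=
    Finset.dvd_sum fun i _ => h.trans (sub_one_dvd_pow_sub_one a i)
  rw [Finset.sum_sub_distrib] at h₁
  simpa using dvd_add h₁ (dvd_refl (n : R))

lemma pow_dvd_geom_sum_pow {n : ℕ} {a : R} (h : (n : R) ∣ a - 1) (N : ℕ) :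
    (n : R) ^ N ∣ ∑ i ∈ Finset.range (n ^ N), a ^ i := by
  induction N with
  | zero => simp
  | succ N ih =>
    have key : ∀ m : ℕ, ∑ i ∈ Finset.range (n ^ N * m), a ^ i =
        (∑ i ∈ Finset.range (n ^ N), a ^ i) * ∑ j ∈ Finset.range m, (a ^ n ^ N) ^ j := by
      intro m
      induction m with
      | zero => simp
      | succ m ihm =>
        simp only [Nat.mul_succ, Finset.sum_range_add, ihm, Finset.sum_range_succ, pow_add,
          ← Finset.mul_sum, pow_mul]
        ring
    rw [pow_succ n N, key, pow_succ (n : R) N]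
    exact mul_dvd_mul ih
      (dvd_geom_sum_of_dvd_sub_one (h.trans (sub_one_dvd_pow_sub_one a _)))

lemma pow_succ_dvd_pow_sub_one {n N : ℕ} {a : R} (hN : N ≠ 0) (h : (n : R) ^ N ∣ a - 1) :
    (n : R) ^ (N + 1) ∣ a ^ n - 1 := by
  rw [← mul_geom_sum, pow_succ]
  exact mul_dvd_mul h (dvd_geom_sum_of_dvd_sub_one ((dvd_pow_self _ hN).trans h))

lemma dvd_prod_sub_prod {ι : Type*} {d : R} (s : Finset ι) {f g : ι → R}
    (h : ∀ i ∈ s, d ∣ f i - g i) : d ∣ ∏ i ∈ s, f i - ∏ i ∈ s, g i := by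
  simp only [← Ideal.mem_span_singleton, ← Ideal.Quotient.eq, map_prod] at h ⊢
  exact Finset.prod_congr rfl h

lemma dvd_prod_range_mul_sub_pow {d : R} {g : ℕ → R} {m : ℕ}
    (hg : ∀ i, d ∣ g (m + i) - g i) (k : ℕ) :
    d ∣ ∏ i ∈ Finset.range (m * k), g i - (∏ i ∈ Finset.range m, g i) ^ k := by
  induction k with
  | zero => simp
  | succ k ih =>
    rw [Nat.mul_succ, add_comm, Finset.prod_range_add, pow_succ']
    have h₁ := dvd_prod_sub_prod (Finset.range (m * k)) fun i _ => hg i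
    have h₂ := (dvd_add h₁ ih).mul_left (∏ i ∈ Finset.range m, g i)
    convert h₂ using 1
    ring

end Congruences

section QGamma

variable {p : ℕ} [Fact p.Prime] {q : ℤ_[p]}

/-- The factors of the `p`-adic `q`-gamma function: `Γ_{p,q}(n) = ∏_{i<n} qGammaFactor q i`. -/
noncomputable def qGammaFactor (q : ℤ_[p]) (i : ℕ) : ℤ_[p] :=
  -(if p ∣ i then 1 else qInt q i)

/-- The values of the `p`-adic `q`-gamma function at natural numbers. -/
noncomputable def qGammaNat (q : ℤ_[p]) (n : ℕ) : ℤ_[p] :=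
  ∏ i ∈ Finset.range n, qGammaFactor q i

lemma qGammaNat_eq (q : ℤ_[p]) (n : ℕ) :
    qGammaNat q n =
      (-1) ^ n * ∏ i ∈ (Finset.Ioo 0 n).filter (fun i => ¬ p ∣ i), qInt q i := by
  have hs : (Finset.Ioo 0 n).filter (fun i => ¬ p ∣ i) =
      (Finset.range n).filter (fun i => ¬ p ∣ i) := by
    ext i
    simp only [Finset.mem_filter, Finset.mem_Ioo, Finset.mem_range]
    refine ⟨fun h => ⟨h.1.2, h.2⟩, fun h => ⟨⟨Nat.pos_of_ne_zero ?_, h.1⟩, h.2⟩⟩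
    rintro rfl
    exact h.2 (dvd_zero p)
  simp only [qGammaNat, qGammaFactor]
  rw [Finset.prod_neg, Finset.card_range, hs, Finset.prod_filter]
  simp only [ite_not]

lemma pow_dvd_qGammaFactor_sub (hq : (p : ℤ_[p]) ∣ q - 1) {N : ℕ} (hN : N ≠ 0) (i : ℕ) :
    (p : ℤ_[p]) ^ N ∣ qGammaFactor q (p ^ N + i) - qGammaFactor q i := by
  have hdvd : p ∣ p ^ N + i ↔ p ∣ i := (Nat.dvd_add_iff_right (dvd_pow_self p hN)).symm
  unfold qGammaFactor
  simp only [hdvd]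
  split_ifs
  · simp
  · have h : qInt q (p ^ N + i) - qInt q i = q ^ i * qInt q (p ^ N) := by
      simp only [qInt, add_comm (p ^ N) i, Finset.sum_range_add, pow_add, Finset.mul_sum]
      ring
    rw [neg_sub_neg, ← neg_sub, h, dvd_neg]
    exact (pow_dvd_geom_sum_pow hq N).mul_left _

lemma dvd_qGammaNat_prime_sub_one (hq : (p : ℤ_[p]) ∣ q - 1) :
    (p : ℤ_[p]) ∣ qGammaNat q p - 1 := by
  have hker : ∀ x : ℤ_[p], (p : ℤ_[p]) ∣ x ↔ PadicInt.toZMod x = 0 := fun x => by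
    rw [← RingHom.mem_ker, PadicInt.ker_toZMod, PadicInt.maximalIdeal_eq_span_p,
      Ideal.mem_span_singleton]
  have hq₁ : PadicInt.toZMod q = 1 := by
    rw [hker, map_sub, map_one] at hq
    exact sub_eq_zero.mp hq
  obtain ⟨m, hm⟩ : ∃ m, p = m + 1 :=
    ⟨p - 1, (Nat.sub_add_cancel (Fact.out : p.Prime).one_le).symm⟩
  have hfac : ∀ i ∈ Finset.range m,
      PadicInt.toZMod (qGammaFactor q (i + 1)) = -((i + 1 : ℕ) : ZMod p) := by
    intro i hi
    have hi' : ¬ p ∣ i + 1 := fun h => by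
      have := Nat.le_of_dvd (Nat.succ_pos i) h
      have := Finset.mem_range.mp hi
      omega
    simp [qGammaFactor, hi', qInt, hq₁]
  have hrange : qGammaNat q p = ∏ i ∈ Finset.range (m + 1), qGammaFactor q i := by
    rw [← hm, qGammaNat]
  have hw := ZMod.wilsons_lemma p
  rw [show p - 1 = m by omega] at hw
  have hpow : (-1 : ZMod p) ^ (m + 1) = -1 := by
    rw [← hm]
    exact ZMod.pow_card _
  rw [hker, map_sub, map_one, hrange, Finset.prod_range_succ', map_mul, map_prod,
    Finset.prod_congr rfl hfac, Finset.prod_neg, Finset.card_range, ← Nat.cast_prod,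
    Finset.prod_range_add_one_eq_factorial, hw]
  have h0 : PadicInt.toZMod (qGammaFactor q 0) = -1 := by simp [qGammaFactor]
  rw [h0]
  linear_combination -hpow

lemma pow_dvd_qGammaNat_pow_sub_one (hq : (p : ℤ_[p]) ∣ q - 1) (N : ℕ) :
    (p : ℤ_[p]) ^ N ∣ qGammaNat q (p ^ (N + 1)) - 1 := by
  have step : ∀ N : ℕ, (p : ℤ_[p]) ^ (N + 1) ∣
      qGammaNat q (p ^ (N + 2)) - qGammaNat q (p ^ (N + 1)) ^ p := fun N => by
    rw [pow_succ p (N + 1)]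
    exact dvd_prod_range_mul_sub_pow (pow_dvd_qGammaFactor_sub hq N.succ_ne_zero) p
  induction N with
  | zero => simp
  | succ N ih =>
    have h : (p : ℤ_[p]) ^ (N + 1) ∣ qGammaNat q (p ^ (N + 1)) ^ p - 1 := by
      rcases eq_or_ne N 0 with rfl | hN
      · simpa using (dvd_qGammaNat_prime_sub_one hq).trans
          (sub_one_dvd_pow_sub_one (qGammaNat q p) p)
      · exact pow_succ_dvd_pow_sub_one hN ih
    simpa using dvd_add (step N) h

lemma pow_dvd_qGammaNat_add_sub (hq : (p : ℤ_[p]) ∣ q - 1) (N n t : ℕ) :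
    (p : ℤ_[p]) ^ N ∣ qGammaNat q (n + p ^ (N + 1) * t) - qGammaNat q n := by
  induction t with
  | zero => simp
  | succ t ih =>
    set m := n + p ^ (N + 1) * t with hm
    have hsplit : qGammaNat q (n + p ^ (N + 1) * (t + 1)) = qGammaNat q (p ^ (N + 1)) *
        ∏ i ∈ Finset.range m, qGammaFactor q (p ^ (N + 1) + i) := by
      rw [show n + p ^ (N + 1) * (t + 1) = p ^ (N + 1) + m by rw [hm]; ring, qGammaNat,
        Finset.prod_range_add, qGammaNat]
    have h₁ : (p : ℤ_[p]) ^ N ∣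
        ∏ i ∈ Finset.range m, qGammaFactor q (p ^ (N + 1) + i) - qGammaNat q m :=
      (pow_dvd_pow _ N.le_succ).trans
        (dvd_prod_sub_prod _ fun i _ => pow_dvd_qGammaFactor_sub hq N.succ_ne_zero i)
    have h₂ := (pow_dvd_qGammaNat_pow_sub_one hq N).mul_right (qGammaNat q m)
    have h₃ := dvd_add (dvd_add (h₁.mul_left (qGammaNat q (p ^ (N + 1)))) h₂) ih
    rw [hsplit]
    convert h₃ using 1
    ring

lemma pow_dvd_qGammaNat_sub (hq : (p : ℤ_[p]) ∣ q - 1) {N m n : ℕ}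
    (h : (p : ℤ_[p]) ^ (N + 1) ∣ (m : ℤ_[p]) - n) :
    (p : ℤ_[p]) ^ N ∣ qGammaNat q m - qGammaNat q n := by
  wlog hnm : n ≤ m generalizing m n
  · rw [← dvd_neg, neg_sub] at h ⊢
    exact this h (le_of_not_ge hnm)
  have h' : ((p ^ (N + 1) : ℕ) : ℤ) ∣ ((m - n : ℕ) : ℤ) := by
    rw [Nat.cast_pow, ← PadicInt.pow_p_dvd_int_iff, Int.cast_natCast, Nat.cast_sub hnm]
    exact h
  obtain ⟨t, ht⟩ := Int.natCast_dvd_natCast.mp h'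
  obtain rfl : m = n + p ^ (N + 1) * t := by omega
  exact pow_dvd_qGammaNat_add_sub hq N n t

/-- A function on `ℕ` that is uniformly continuous for the `p`-adic metric extends to `ℤ_p`. -/
lemma exists_continuousMap_extending {F : ℕ → ℤ_[p]}
    (hF : ∀ N m n : ℕ, (p : ℤ_[p]) ^ (N + 1) ∣ (m : ℤ_[p]) - n → (p : ℤ_[p]) ^ N ∣ F m - F n) :
    ∃ f : C(ℤ_[p], ℤ_[p]), ∀ n : ℕ, f n = F n := by
  have hd : Dense (Set.range (Nat.cast : ℕ → ℤ_[p])) := PadicInt.denseRange_natCast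
  let G : Set.range (Nat.cast : ℕ → ℤ_[p]) → ℤ_[p] := fun x => F x.2.choose
  have hGF : ∀ n : ℕ, G ⟨n, n, rfl⟩ = F n := fun n =>
    congrArg F (Nat.cast_injective
      (Exists.choose_spec (⟨n, rfl⟩ : ∃ m : ℕ, (m : ℤ_[p]) = (n : ℤ_[p]))))
  have hnorm : ∀ (x : ℤ_[p]) (N : ℕ), ‖x‖ ≤ (p : ℝ) ^ (-(N : ℤ)) ↔ (p : ℤ_[p]) ^ N ∣ x :=
    fun x N => by rw [PadicInt.norm_le_pow_iff_mem_span_pow, Ideal.mem_span_singleton]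
  have hG : UniformContinuous G := by
    rw [Metric.uniformContinuous_iff]
    intro ε hε
    obtain ⟨N, hN⟩ := PadicInt.exists_pow_neg_lt p hε
    refine ⟨(p : ℝ) ^ (-((N + 1 : ℕ) : ℤ)),
      zpow_pos (Nat.cast_pos.mpr (Fact.out : p.Prime).pos) _, ?_⟩
    rintro ⟨_, m, rfl⟩ ⟨_, n, rfl⟩ h
    rw [hGF, hGF, dist_eq_norm]
    refine lt_of_le_of_lt ((hnorm _ _).mpr (hF N m n ((hnorm _ _).mp ?_))) hN
    rw [← dist_eq_norm]
    exact h.le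
  exact ⟨⟨hd.extend G, (hd.uniformContinuous_extend hG).continuous⟩, fun n =>
    (hd.extend_of_ind hG ⟨n, n, rfl⟩).trans (hGF n)⟩

end QGamma

/-- Koblitz: for a prime `p` and `q ∈ ℤ_p` with `‖q - 1‖ ≤ 1/p`, there is a
unique continuous function `f : ℤ_p → ℚ_p` with
`f(n) = (-1)^n · ∏_{0<i<n, p∤i} [i]_q` for all natural numbers `n`
(the `p`-adic `q`-gamma function `Γ_{p,q}`). -/
theorem koblitz_padic_qgamma
    (p : ℕ) (hp : p.Prime) [Fact p.Prime] (q : ℤ_[p]) (hq : ‖q - 1‖ ≤ (p : ℝ)⁻¹) :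
    ∃! f : C(ℤ_[p], ℚ_[p]), ∀ n : ℕ,
      f (n : ℤ_[p]) = (-1) ^ n *
        ((∏ i ∈ (Finset.Ioo 0 n).filter (fun i => ¬ p ∣ i), qInt q i : ℤ_[p]) : ℚ_[p]) := by
  have hq' : (p : ℤ_[p]) ∣ q - 1 := by
    rw [← PadicInt.norm_lt_one_iff_dvd]
    exact hq.trans_lt (inv_lt_one_of_one_lt₀ (Nat.one_lt_cast.mpr hp.one_lt))
  obtain ⟨f, hf⟩ := exists_continuousMap_extending fun N m n h =>
    pow_dvd_qGammaNat_sub hq' (N := N) (m := m) (n := n) h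
  refine ⟨⟨fun x => (f x : ℚ_[p]), continuous_subtype_val.comp f.continuous⟩,
    fun n => ?_, fun g hg => ?_⟩
  · simp [hf, qGammaNat_eq]
  · refine ContinuousMap.coe_injective (PadicInt.denseRange_natCast.equalizer
      g.continuous (ContinuousMap.continuous _) (funext fun n => ?_))
    simp [hg, hf, qGammaNat_eq]
end
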